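/- Let A be an n×n Manin matrix with entries in an associative unital algebra over ℂ. If two distinct columns of A are equal, then cdet A = 0. -/

import Mathlib

open scoped BigOperators

/-- The column-determinant of a matrix over a (noncommutative) ring:
`cdet A = Σ_σ sgn σ · a_{σ(1)1} a_{σ(2)2} ⋯ a_{σ(n)n}`, factors ordered by
column index. -/
noncomputable def cdet {R : Type*} [Ring R] {n : ℕ} (A : Matrix (Fin n) (Fin n) R) : R :=
  ∑ σ : Equiv.Perm (Fin n),
    (Equiv.Perm.sign σ : ℤ) • (List.ofFn fun j : Fin n => A (σ j) j).prod
/-- A square matrix `A = [a_{ij}]` with entries in a ring is a Manin matrix if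
`a_{ij} a_{kl} - a_{kl} a_{ij} = a_{kj} a_{il} - a_{il} a_{kj}` for all
`i, j, k, l`. -/
def IsManin {R : Type*} [Ring R] {n : ℕ} (A : Matrix (Fin n) (Fin n) R) : Prop :=
  ∀ i j k l : Fin n, A i j * A k l - A k l * A i j = A k j * A i l - A i l * A k j

theorem exists_prod_ofFn_eq_mul_adjacent {M : Type*} [Monoid M] {n : ℕ} (i : Fin n)
    (f : Fin (n + 1) → M) :
    ∃ x y : M, ∀ g : Fin (n + 1) → M,
      (∀ j, j ≠ i.castSucc → j ≠ i.succ → g j = f j) →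
        (List.ofFn g).prod = x * (g i.castSucc * g i.succ) * y := by
  induction n with
  | zero => exact i.elim0
  | succ n ih =>
    refine Fin.cases ?_ (fun k => ?_) i
    · refine ⟨1, (List.ofFn fun j : Fin n => f j.succ.succ).prod, fun g hg => ?_⟩
      have htail : (fun j : Fin n => g j.succ.succ) = fun j => f j.succ.succ := by
        funext j
        apply hg <;> simp [Fin.ext_iff]
      rw [List.ofFn_succ, List.ofFn_succ, htail]
      simp [mul_assoc]
    · obtain ⟨x, y, h⟩ := ih k fun j => f j.succ
      refine ⟨f 0 * x, y, fun g hg => ?_⟩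
      have h0 : g 0 = f 0 := by
        apply hg <;> simp [Fin.ext_iff]
      have htail := h (fun j => g j.succ) fun j hj hj' => hg j.succ
        (by simpa [Fin.ext_iff] using hj) (by simpa [Fin.ext_iff] using hj')
      rw [List.ofFn_succ, List.prod_cons, htail, h0]
      simp [mul_assoc, Fin.castSucc_succ]

theorem IsManin.submatrix_id {R : Type*} [Ring R] {n : ℕ} {A : Matrix (Fin n) (Fin n) R}
    (hA : IsManin A) (c : Fin n → Fin n) : IsManin (A.submatrix id c) :=
  fun i j k l => hA i (c j) k (c l)

theorem IsManin.cdet_submatrix_swap_adjacent {R : Type*} [Ring R] {n : ℕ}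
    {A : Matrix (Fin (n + 1)) (Fin (n + 1)) R} (hA : IsManin A) (i : Fin n) :
    cdet (A.submatrix id (Equiv.swap i.castSucc i.succ)) = -cdet A := by
  have hne : i.castSucc ≠ i.succ := Fin.castSucc_lt_succ.ne
  rw [eq_neg_iff_add_eq_zero, cdet, cdet, ← Finset.sum_add_distrib]
  refine Finset.sum_involution (fun σ _ => σ * Equiv.swap i.castSucc i.succ) (fun σ _ => ?_)
    (fun σ _ _ h => hne (Equiv.swap_eq_one_iff.mp (mul_eq_left.mp h)))
    (fun _ _ => Finset.mem_univ _) (fun σ _ => by simp [mul_assoc])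
  obtain ⟨x, y, h⟩ := exists_prod_ofFn_eq_mul_adjacent i fun j => A (σ j) j
  rw [h, h, h, h]
  · have hM := hA (σ i.castSucc) i.castSucc (σ i.succ) i.succ
    simp only [Matrix.submatrix_apply, id_eq, Equiv.swap_apply_left, Equiv.swap_apply_right,
      Equiv.Perm.mul_apply, Equiv.Perm.sign_mul, Equiv.Perm.sign_swap hne, mul_neg, mul_one,
      Units.val_neg, neg_smul, ← smul_add, ← smul_neg, ← neg_add, ← mul_add, ← add_mul]
    rw [← sub_eq_add_neg, ← sub_mul, ← mul_sub]
    have hz : A (σ i.castSucc) i.succ * A (σ i.succ) i.castSucc +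
        A (σ i.castSucc) i.castSucc * A (σ i.succ) i.succ -
        (A (σ i.succ) i.succ * A (σ i.castSucc) i.castSucc +
        A (σ i.succ) i.castSucc * A (σ i.castSucc) i.succ) = 0 := by
      rw [← sub_eq_zero] at hM
      rw [← hM]
      abel
    rw [hz]
    simp
  all_goals
    intro j hj hj'
    simp [Equiv.swap_apply_of_ne_of_ne hj hj']

theorem IsManin.cdet_submatrix_perm {R : Type*} [Ring R] {n : ℕ}
    {A : Matrix (Fin n) (Fin n) R} (hA : IsManin A) (τ : Equiv.Perm (Fin n)) :
    cdet (A.submatrix id τ) = (Equiv.Perm.sign τ : ℤ) • cdet A := by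
  cases n with
  | zero => simp [Subsingleton.elim τ 1]
  | succ n =>
    have hτ : τ ∈ Submonoid.closure
        (Set.range fun i : Fin n => Equiv.swap i.castSucc i.succ) := by
      rw [Equiv.Perm.mclosure_swap_castSucc_succ]
      trivial
    induction hτ using Submonoid.closure_induction generalizing A with
    | mem τ h =>
      obtain ⟨i, rfl⟩ := h
      simp [hA.cdet_submatrix_swap_adjacent i, Equiv.Perm.sign_swap Fin.castSucc_lt_succ.ne]
    | one => simp
    | mul τ ρ _ _ ihτ ihρ =>
      have h := ihρ (hA.submatrix_id τ)
      rw [Matrix.submatrix_submatrix, ihτ hA, smul_smul] at h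
      rw [Equiv.Perm.sign_mul, Units.val_mul, mul_comm, ← h]
      rfl

/-- if two distinct columns of a Manin matrix with entries in an
associative unital algebra over ℂ are equal, its column-determinant is zero. -/
theorem cdet_eq_zero_of_cols_eq_manin {R : Type*} [Ring R] [Algebra ℂ R] {n : ℕ}
    (A : Matrix (Fin n) (Fin n) R) (hA : IsManin A)
    (p q : Fin n) (hpq : p ≠ q) (hcols : ∀ m, A m p = A m q) :
    cdet A = 0 := by
  have h := hA.cdet_submatrix_perm (Equiv.swap p q)
  have hfix : A.submatrix id (Equiv.swap p q) = A := by
    ext m j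
    rcases eq_or_ne j p with rfl | hp
    · simp [hcols]
    rcases eq_or_ne j q with rfl | hq
    · simp [hcols]
    simp [Equiv.swap_apply_of_ne_of_ne hp hq]
  rw [hfix, Equiv.Perm.sign_swap hpq, Units.val_neg, Units.val_one, neg_one_smul] at h
  have htwo : (2 : ℂ) • cdet A = 0 := by
    rw [two_smul]
    exact eq_neg_iff_add_eq_zero.mp h
  exact (smul_eq_zero_iff_right two_ne_zero).mp htwo
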